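/- Let G be a connected simple graph on a finite vertex type V that is unicyclic (i.e. G.edgeFinset.card = Fintype.card V), and let H be a connected simple graph on a finite vertex type W that is orbitally similar to G. Then H is unicyclic as well: H.edgeFinset.card = Fintype.card W. -/

import Mathlib

open Classical Finset

/-- `O : Fin ℓ → Finset V` is an orbit enumeration of the graph `G`:
every vertex lies in exactly one `O i`, and each `O i` is an orbit of the
automorphism group of `G` acting on the vertices. -/
def IsOrbitEnum {V : Type*} (G : SimpleGraph V) {ℓ : ℕ} (O : Fin ℓ → Finset V) : Prop :=
  (∀ v : V, ∃! i, v ∈ O i) ∧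
  ∀ i : Fin ℓ, ∃ w : V, ∀ v : V, v ∈ O i ↔ ∃ φ : G ≃g G, φ w = v

/-- `S` is the orbit divisor matrix of `G` relative to the orbit enumeration `O`:
for every vertex `u ∈ O i`, the number of vertices of `O j` adjacent to `u` is `S i j`. -/
def IsOrbitDivisorMatrix {V : Type*} (G : SimpleGraph V) {ℓ : ℕ}
    (O : Fin ℓ → Finset V) (S : Matrix (Fin ℓ) (Fin ℓ) ℕ) : Prop :=
  ∀ i j : Fin ℓ, ∀ u ∈ O i, ((O j).filter fun v => G.Adj u v).card = S i j

/-- Two graphs are orbitally similar if they admit orbit enumerations with a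
common orbit divisor matrix. -/
def OrbitallySimilar {V W : Type*} (G : SimpleGraph V) (H : SimpleGraph W) : Prop :=
  ∃ (ℓ : ℕ) (O : Fin ℓ → Finset V) (Q : Fin ℓ → Finset W) (S : Matrix (Fin ℓ) (Fin ℓ) ℕ),
    IsOrbitEnum G O ∧ IsOrbitEnum H Q ∧
    IsOrbitDivisorMatrix G O S ∧ IsOrbitDivisorMatrix H Q S

/-- Summing over the vertices amounts to summing over the cells of an orbit enumeration. -/
lemma IsOrbitEnum.sum_cells {V : Type*} [Fintype V] {G : SimpleGraph V} {ℓ : ℕ}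
    {O : Fin ℓ → Finset V} (hO : IsOrbitEnum G O) (f : V → ℕ) :
    ∑ i, ∑ v ∈ O i, f v = ∑ v, f v := by
  choose c hc hcu using hO.1
  have h : ∀ i, O i = univ.filter fun v => c v = i := fun i => by
    ext v
    simp only [mem_filter, mem_univ, true_and]
    exact ⟨fun hv => (hcu v i hv).symm, fun hv => hv ▸ hc v⟩
  simp only [h]
  exact sum_fiberwise _ _ _

lemma IsOrbitEnum.card_pos {V : Type*} {G : SimpleGraph V} {ℓ : ℕ}
    {O : Fin ℓ → Finset V} (hO : IsOrbitEnum G O) (i : Fin ℓ) : 0 < (O i).card := by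
  obtain ⟨w, hw⟩ := hO.2 i
  exact Finset.card_pos.2 ⟨w, (hw w).2 ⟨RelIso.refl _, rfl⟩⟩

lemma IsOrbitEnum.sum_card {V : Type*} [Fintype V] {G : SimpleGraph V} {ℓ : ℕ}
    {O : Fin ℓ → Finset V} (hO : IsOrbitEnum G O) :
    ∑ i, (O i).card = Fintype.card V := by
  simpa using hO.sum_cells fun _ => 1

/-- Double counting of the edges between two cells. -/
lemma IsOrbitDivisorMatrix.card_mul_comm {V : Type*} {G : SimpleGraph V} {ℓ : ℕ}
    {O : Fin ℓ → Finset V} {S : Matrix (Fin ℓ) (Fin ℓ) ℕ} (hS : IsOrbitDivisorMatrix G O S)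
    (i j : Fin ℓ) : (O i).card * S i j = (O j).card * S j i := by
  refine card_mul_eq_card_mul G.Adj (fun u hu => hS i j u hu) fun v hv => ?_
  rw [← hS j i v hv]
  simp only [bipartiteBelow, G.adj_comm]

/-- The degree sum of a graph in terms of its orbit divisor matrix. -/
lemma IsOrbitDivisorMatrix.sum_eq_two_mul_card_edgeFinset {V : Type*} [Fintype V]
    {G : SimpleGraph V} [Fintype G.edgeSet] {ℓ : ℕ} {O : Fin ℓ → Finset V}
    {S : Matrix (Fin ℓ) (Fin ℓ) ℕ} (hO : IsOrbitEnum G O) (hS : IsOrbitDivisorMatrix G O S) :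
    ∑ i, (O i).card * ∑ j, S i j = 2 * G.edgeFinset.card := by
  have hdeg : ∀ i, ∀ u ∈ O i, G.degree u = ∑ j, S i j := fun i u hu => by
    rw [← sum_congr rfl fun j _ => hS i j u hu]
    simp only [card_filter]
    refine Eq.trans ?_ (hO.sum_cells fun v => if G.Adj u v then 1 else 0).symm
    rw [← card_filter, ← G.card_neighborFinset_eq_degree]
    congr 1
    ext v
    simp
  have hsum : 2 * G.edgeFinset.card = ∑ v, G.degree v := by
    convert G.sum_degrees_eq_twice_card_edges.symm
  rw [hsum, ← hO.sum_cells]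
  exact sum_congr rfl fun i _ => by rw [sum_congr rfl (hdeg i), sum_const, smul_eq_mul]

/-- The cell sizes of two graphs with a common orbit divisor matrix are proportional
if one of the graphs is connected. -/
lemma IsOrbitDivisorMatrix.card_mul_card_eq {V W : Type*} {G : SimpleGraph V}
    {H : SimpleGraph W} (hG : G.Connected) {ℓ : ℕ} {O : Fin ℓ → Finset V}
    {Q : Fin ℓ → Finset W} {S : Matrix (Fin ℓ) (Fin ℓ) ℕ} (hO : IsOrbitEnum G O)
    (hS : IsOrbitDivisorMatrix G O S) (hT : IsOrbitDivisorMatrix H Q S) (i j : Fin ℓ) :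
    (O i).card * (Q j).card = (O j).card * (Q i).card := by
  have adj_pos : ∀ i j u v, u ∈ O i → v ∈ O j → G.Adj u v → 0 < S i j :=
    fun i j u v hu hv huv => by
      rw [← hS i j u hu]
      exact Finset.card_pos.2 ⟨v, mem_filter.2 ⟨hv, huv⟩⟩
  have step : ∀ i j, 0 < S i j → 0 < S j i →
      (O i).card * (Q j).card = (O j).card * (Q i).card := fun i j hij hji => by
    have h₁ := hS.card_mul_comm i j
    have h₂ := hT.card_mul_comm i j
    apply Nat.eq_of_mul_eq_mul_right (Nat.mul_pos hij hji)
    calc (O i).card * (Q j).card * (S i j * S j i)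
        = ((O i).card * S i j) * ((Q j).card * S j i) := by ring
      _ = ((O j).card * S j i) * ((Q i).card * S i j) := by rw [h₁, h₂]
      _ = (O j).card * (Q i).card * (S i j * S j i) := by ring
  obtain ⟨u, hu⟩ := Finset.card_pos.1 (hO.card_pos i)
  obtain ⟨v, hv⟩ := Finset.card_pos.1 (hO.card_pos j)
  obtain ⟨p⟩ := hG.preconnected u v
  induction p generalizing i with
  | nil => rw [(hO.1 _).unique hu hv]
  | @cons u w v huw p ih =>
    obtain ⟨k, hk, -⟩ := hO.1 w
    have h₁ := step i k (adj_pos i k u w hu hk huw) (adj_pos k i w u hk hu huw.symm)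
    have h₂ := ih k hk hv
    apply Nat.eq_of_mul_eq_mul_right (hO.card_pos k)
    calc (O i).card * (Q j).card * (O k).card
        = (O i).card * ((O k).card * (Q j).card) := by ring
      _ = (O j).card * ((O i).card * (Q k).card) := by rw [h₂]; ring
      _ = (O j).card * (Q i).card * (O k).card := by rw [h₁]; ring

/-- A connected graph orbitally similar to a unicyclic connected graph is
unicyclic as well. -/
theorem unicyclic_of_orbitally_similar {V W : Type*}
    [Fintype V] [Fintype W] [DecidableEq V] [DecidableEq W]
    (G : SimpleGraph V) (H : SimpleGraph W) [DecidableRel G.Adj] [DecidableRel H.Adj]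
    (hG : G.Connected) (hH : H.Connected)
    (huni : G.edgeFinset.card = Fintype.card V)
    (hGH : OrbitallySimilar G H) :
    H.edgeFinset.card = Fintype.card W := by
  obtain ⟨ℓ, O, Q, S, hO, hQ, hS, hT⟩ := hGH
  obtain ⟨v⟩ := hG.nonempty
  obtain ⟨i, -, -⟩ := hO.1 v
  have hprop := hS.card_mul_card_eq hG hO hT i
  have hcard : (O i).card * Fintype.card W = Fintype.card V * (Q i).card := by
    rw [← hO.sum_card, ← hQ.sum_card, mul_sum, sum_mul]
    exact sum_congr rfl fun j _ => hprop j
  have hedge : (O i).card * (2 * H.edgeFinset.card) = 2 * G.edgeFinset.card * (Q i).card := by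
    rw [← hS.sum_eq_two_mul_card_edgeFinset hO, ← hT.sum_eq_two_mul_card_edgeFinset hQ,
      mul_sum, sum_mul]
    exact sum_congr rfl fun j _ => by rw [← mul_assoc, hprop j, mul_right_comm]
  apply Nat.eq_of_mul_eq_mul_left (hO.card_pos i)
  rw [hcard, ← huni]
  linarith
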